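/- Let n ≥ 3 be odd and let w > 1. Then (2(√2 − 1)w² − 1)(w² − 1)/(w(w^{n+1} − 1)) ≤ λ₁(w) − λ₂(w) ≤ 4(w−1)(w+1)²/(w²(w^{n−1} − 1)). -/

import Mathlib

open Polynomial Real Filter

noncomputable def pathA (n : ℕ) (w : ℝ) : Matrix (Fin n) (Fin n) ℝ :=
  Matrix.of fun i j =>
    if i = j ∧ (i.val = 0 ∨ i.val = n - 1) then w
    else if i.val + 1 = j.val ∨ j.val + 1 = i.val then 1
    else 0

/-- `μ` lists the eigenvalues of `pathA n w` with multiplicity, in decreasing order. -/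
def IsEigList (n : ℕ) (w : ℝ) (μ : Fin n → ℝ) : Prop :=
  Antitone μ ∧ (pathA n w).charpoly = ∏ i, (Polynomial.X - Polynomial.C (μ i))

theorem exists_perm_comp_eq_of_map_univ_eq {ι α : Type*} [Fintype ι] [DecidableEq α]
    {f g : ι → α} (h : Finset.univ.val.map f = Finset.univ.val.map g) :
    ∃ σ : Equiv.Perm ι, ∀ i, g (σ i) = f i := by
  have hcard (c : α) : Fintype.card {i // f i = c} = Fintype.card {i // g i = c} := by
    have hc := congrArg (Multiset.count c) h
    simp only [Multiset.count_map] at hc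
    simpa [Fintype.card_subtype, Finset.card_def, Finset.filter_val, eq_comm] using hc
  exact ⟨Equiv.ofFiberEquiv fun c => Fintype.equivOfCardEq (hcard c),
    fun i => Equiv.ofFiberEquiv_map _ i⟩

section Spectral

open Matrix

variable {n : ℕ} {A : Matrix (Fin n) (Fin n) ℝ} {μ : Fin n → ℝ}

theorem exists_orthonormalBasis_of_charpoly (hA : A.IsHermitian)
    (hμ : A.charpoly = ∏ i, (Polynomial.X - Polynomial.C (μ i))) :
    ∃ b : OrthonormalBasis (Fin n) ℝ (EuclideanSpace ℝ (Fin n)),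
      ∀ i, A *ᵥ (b i).ofLp = μ i • (b i).ofLp := by
  have hroots : Finset.univ.val.map μ = Finset.univ.val.map hA.eigenvalues := by
    have h := hA.roots_charpoly_eq_eigenvalues
    have hm := Multiset.map_map (fun a => Polynomial.X - Polynomial.C a) μ Finset.univ.val
    rw [hμ, Finset.prod_eq_multiset_prod, ← Function.comp_def (fun a => Polynomial.X - _) μ,
      ← hm, Polynomial.roots_multiset_prod_X_sub_C] at h
    exact h
  obtain ⟨σ, hσ⟩ := exists_perm_comp_eq_of_map_univ_eq hroots
  refine ⟨hA.eigenvectorBasis.reindex σ.symm, fun i => ?_⟩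
  have := hA.mulVec_eigenvectorBasis (σ i)
  simpa [hσ] using this

variable {b : OrthonormalBasis (Fin n) ℝ (EuclideanSpace ℝ (Fin n))}

theorem dotProduct_self_eq_sum_sq (b : OrthonormalBasis (Fin n) ℝ (EuclideanSpace ℝ (Fin n)))
    (v : Fin n → ℝ) : v ⬝ᵥ v = ∑ i, (v ⬝ᵥ (b i).ofLp) ^ 2 := by
  have h := b.sum_sq_inner_right (WithLp.toLp 2 v)
  rw [← real_inner_self_eq_norm_sq] at h
  simp only [EuclideanSpace.inner_eq_star_dotProduct, star_trivial] at h
  exact h.symm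

theorem dotProduct_mulVec_eq_sum (hA : A.IsHermitian)
    (hb : ∀ i, A *ᵥ (b i).ofLp = μ i • (b i).ofLp) (v : Fin n → ℝ) :
    v ⬝ᵥ A *ᵥ v = ∑ i, μ i * (v ⬝ᵥ (b i).ofLp) ^ 2 := by
  have h := b.sum_inner_mul_inner (WithLp.toLp 2 v) (WithLp.toLp 2 (A *ᵥ v))
  simp only [EuclideanSpace.inner_eq_star_dotProduct, star_trivial] at h
  rw [dotProduct_comm, ← h]
  refine Finset.sum_congr rfl fun i _ => ?_
  have hT : Aᵀ = A := by simpa using hA.eq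
  rw [dotProduct_comm (A *ᵥ v), dotProduct_mulVec, ← mulVec_transpose, hT, hb, smul_dotProduct,
    dotProduct_comm (b i).ofLp, smul_eq_mul]
  ring

theorem dotProduct_basis (b : OrthonormalBasis (Fin n) ℝ (EuclideanSpace ℝ (Fin n)))
    (i j : Fin n) : (b i).ofLp ⬝ᵥ (b j).ofLp = if i = j then 1 else 0 := by
  have h := orthonormal_iff_ite.1 b.orthonormal j i
  simpa [EuclideanSpace.inner_eq_star_dotProduct, eq_comm] using h

theorem dotProduct_mulVec_le (hA : A.IsHermitian)
    (hb : ∀ i, A *ᵥ (b i).ofLp = μ i • (b i).ofLp) {c : ℝ} {v : Fin n → ℝ}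
    (h : ∀ i, c < μ i → v ⬝ᵥ (b i).ofLp = 0) : v ⬝ᵥ A *ᵥ v ≤ c * (v ⬝ᵥ v) := by
  rw [dotProduct_mulVec_eq_sum hA hb, dotProduct_self_eq_sum_sq b, Finset.mul_sum]
  refine Finset.sum_le_sum fun i _ => ?_
  rcases le_or_gt (μ i) c with hi | hi
  · gcongr
  · simp [h i hi]

/-- Some nonzero vector of any plane has Rayleigh quotient at most the second eigenvalue. -/
theorem exists_combination_dotProduct_mulVec_le (hA : A.IsHermitian)
    (hb : ∀ i, A *ᵥ (b i).ofLp = μ i • (b i).ofLp) {i₀ i₁ : Fin n}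
    (h₁ : ∀ i, i ≠ i₀ → μ i ≤ μ i₁) (v : ℝ → ℝ → Fin n → ℝ)
    (hv : ∀ s t, v s t = s • v 1 0 + t • v 0 1) :
    ∃ s t : ℝ, 0 < s ^ 2 + t ^ 2 ∧ v s t ⬝ᵥ A *ᵥ v s t ≤ μ i₁ * (v s t ⬝ᵥ v s t) := by
  obtain ⟨s, t, hst, h⟩ : ∃ s t : ℝ, 0 < s ^ 2 + t ^ 2 ∧ v s t ⬝ᵥ (b i₀).ofLp = 0 := by
    by_cases hx : v 1 0 ⬝ᵥ (b i₀).ofLp = 0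
    · exact ⟨1, 0, by norm_num, hx⟩
    · refine ⟨-(v 0 1 ⬝ᵥ (b i₀).ofLp), v 1 0 ⬝ᵥ (b i₀).ofLp, by positivity, ?_⟩
      rw [hv, add_dotProduct, smul_dotProduct, smul_dotProduct, smul_eq_mul, smul_eq_mul]
      ring
  refine ⟨s, t, hst, dotProduct_mulVec_le hA hb fun i hi => ?_⟩
  obtain rfl : i = i₀ := by
    by_contra hne
    exact hi.not_ge (h₁ i hne)
  exact h

/-- Some nonzero vector of any coordinate hyperplane has Rayleigh quotient at least the smaller
of two given eigenvalues. -/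
theorem exists_apply_eq_zero_le_dotProduct_mulVec
    (hb : ∀ i, A *ᵥ (b i).ofLp = μ i • (b i).ofLp) {i₀ i₁ : Fin n} (hne : i₀ ≠ i₁)
    (h₁ : μ i₁ ≤ μ i₀) (k : Fin n) :
    ∃ v : Fin n → ℝ, v k = 0 ∧ 0 < v ⬝ᵥ v ∧ μ i₁ * (v ⬝ᵥ v) ≤ v ⬝ᵥ A *ᵥ v := by
  obtain ⟨s, t, hst, h⟩ : ∃ s t : ℝ, 0 < s ^ 2 + t ^ 2 ∧ s * b i₀ k + t * b i₁ k = 0 := by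
    by_cases hx : b i₀ k = 0
    · exact ⟨1, 0, by norm_num, by simp [hx]⟩
    · exact ⟨-(b i₁ k), b i₀ k, by positivity, by ring⟩
  have hnorm : (s • (b i₀).ofLp + t • (b i₁).ofLp) ⬝ᵥ (s • (b i₀).ofLp + t • (b i₁).ofLp)
      = s ^ 2 + t ^ 2 := by
    simp [dotProduct_basis, hne, hne.symm]
    ring
  refine ⟨s • (b i₀).ofLp + t • (b i₁).ofLp, by simpa using h, hnorm ▸ hst, ?_⟩
  rw [hnorm]
  simp [mulVec_add, mulVec_smul, hb, dotProduct_basis, hne, hne.symm]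
  nlinarith [mul_nonneg (sq_nonneg s) (sub_nonneg.2 h₁)]

end Spectral

section QuadraticForm

open Matrix

theorem pathA_isHermitian (n : ℕ) (w : ℝ) : (pathA n w).IsHermitian := by
  ext i j
  simp only [pathA, conjTranspose_apply, of_apply, star_trivial]
  congr 1
  · simp only [eq_iff_iff]
    constructor <;> rintro ⟨rfl, h⟩ <;> exact ⟨rfl, h⟩
  · simp only [or_comm]

theorem sum_range_neighbours (n : ℕ) (g : ℕ → ℝ) :
    ∑ i ∈ Finset.range (n + 1), ∑ j ∈ Finset.range (n + 1),
      g i * ((if i + 1 = j ∨ j + 1 = i then 1 else 0) * g j)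
      = 2 * ∑ k ∈ Finset.range n, g k * g (k + 1) := by
  have h (i j : ℕ) : g i * ((if i + 1 = j ∨ j + 1 = i then 1 else 0) * g j) =
      (if i + 1 = j then g i * g j else 0) + (if j + 1 = i then g j * g i else 0) := by
    split_ifs <;> first | omega | ring
  simp only [h, Finset.sum_add_distrib]
  rw [Finset.sum_comm (f := fun i j => if j + 1 = i then g j * g i else 0), ← two_mul]
  simp [Finset.sum_range_succ]
  refine Finset.sum_congr rfl fun k hk => ?_
  simp at hk
  simp [hk]

/-- The quadratic form of the two-looped path with `2 * m + 1` vertices is the sum of the forms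
of its halves, indexed by the distance to the centre. -/
theorem pathA_dotProduct_mulVec {m : ℕ} (hm : 1 ≤ m) (w : ℝ) (g : ℕ → ℝ) :
    (fun i : Fin (2 * m + 1) => g i) ⬝ᵥ
        pathA (2 * m + 1) w *ᵥ (fun i : Fin (2 * m + 1) => g i) =
      (w * g (m - m) ^ 2 + 2 * ∑ j ∈ Finset.range m, g (m - j) * g (m - (j + 1))) +
      (w * g (m + m) ^ 2 + 2 * ∑ j ∈ Finset.range m, g (m + j) * g (m + (j + 1))) := by
  have hentry (i j : Fin (2 * m + 1)) : g i * (pathA (2 * m + 1) w i j * g j) =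
      (if i.val = j.val then
        (if i.val = 0 then w * g i ^ 2 else 0) + (if i.val = 2 * m then w * g i ^ 2 else 0)
        else 0) +
      g i * ((if i.val + 1 = j.val ∨ j.val + 1 = i.val then 1 else 0) * g j) := by
    simp only [pathA, of_apply, Fin.ext_iff]
    by_cases hij : i.val = j.val
    · rw [← hij]
      split_ifs <;> first | omega | ring
    · simp [hij]
  have hsum : ∑ k ∈ Finset.range (2 * m), g k * g (k + 1) =
      (∑ j ∈ Finset.range m, g (m - j) * g (m - (j + 1))) +
        ∑ j ∈ Finset.range m, g (m + j) * g (m + (j + 1)) := by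
    rw [two_mul, Finset.sum_range_add, ← Finset.sum_range_reflect]
    congr 1
    refine Finset.sum_congr rfl fun j hj => ?_
    have hj := Finset.mem_range.1 hj
    rw [mul_comm, show m - 1 - j = m - (j + 1) by omega, show m - (j + 1) + 1 = m - j by omega]
  simp only [dotProduct, mulVec, Finset.mul_sum, hentry, Finset.sum_add_distrib]
  rw [Fin.sum_univ_eq_sum_range (fun i => ∑ j : Fin (2 * m + 1),
      g i * ((if i + 1 = j.val ∨ j.val + 1 = i then 1 else 0) * g j)),
    Finset.sum_congr rfl fun i _ => Fin.sum_univ_eq_sum_range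
      (fun j => g i * ((if i + 1 = j ∨ j + 1 = i then 1 else 0) * g j)) (2 * m + 1),
    sum_range_neighbours, hsum]
  have hdiag : ∑ i : Fin (2 * m + 1), ∑ j : Fin (2 * m + 1), (if i.val = j.val then
        (if i.val = 0 then w * g i ^ 2 else 0) + (if i.val = 2 * m then w * g i ^ 2 else 0)
        else 0) = w * g 0 ^ 2 + w * g (2 * m) ^ 2 := by
    simp only [← Fin.ext_iff, Finset.sum_ite_eq, Finset.mem_univ, if_true, Finset.sum_add_distrib]
    rw [Fin.sum_univ_eq_sum_range (fun i => if i = 0 then w * g i ^ 2 else 0),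
      Fin.sum_univ_eq_sum_range (fun i => if i = 2 * m then w * g i ^ 2 else 0)]
    simp
  rw [hdiag, Nat.sub_self, ← two_mul]
  simp only [← Finset.mul_sum]
  ring

theorem dotProduct_self_halves (m : ℕ) (g : ℕ → ℝ) :
    (fun i : Fin (2 * m + 1) => g i) ⬝ᵥ (fun i : Fin (2 * m + 1) => g i) =
      g m ^ 2 + ∑ j ∈ Finset.range m, g (m - (j + 1)) ^ 2 +
        ∑ j ∈ Finset.range m, g (m + (j + 1)) ^ 2 := by
  rw [dotProduct, Fin.sum_univ_eq_sum_range (fun i => g i * g i),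
    show 2 * m + 1 = m + (m + 1) by omega, Finset.sum_range_add, ← Finset.sum_range_reflect,
    Finset.sum_range_succ']
  simp only [← sq]
  simp only [Nat.sub_sub, add_comm 1, add_zero]
  ring

end QuadraticForm

section HalfPath

variable {w : ℝ}

theorem half_form_le (hw : 0 < w) (f : ℕ → ℝ) (m : ℕ) :
    w * f m ^ 2 + 2 * ∑ j ∈ Finset.range m, f j * f (j + 1) ≤
      w * f 0 ^ 2 + (w + 1 / w) * ∑ j ∈ Finset.range m, f (j + 1) ^ 2 := by
  induction m with
  | zero => simp
  | succ m ih =>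
    rw [Finset.sum_range_succ, Finset.sum_range_succ]
    have h : 0 ≤ (w * f m - f (m + 1)) ^ 2 / w := by positivity
    have h2 : (w * f m - f (m + 1)) ^ 2 / w =
      w * f m ^ 2 - 2 * (f m * f (m + 1)) + 1 / w * f (m + 1) ^ 2 := by field_simp; ring
    linarith

/-- The ratio of consecutive entries of the vector `j ↦ w ^ j + w⁻¹ ^ j`. -/
noncomputable def coshRatio (w : ℝ) (m : ℕ) : ℝ :=
  (w ^ (2 * m + 2) + 1) / (w * (w ^ (2 * m) + 1))

theorem coshRatio_pos (hw : 0 < w) (m : ℕ) : 0 < coshRatio w m := by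
  unfold coshRatio; positivity

theorem coshRatio_succ (hw : 0 < w) (m : ℕ) :
    coshRatio w (m + 1) = w + 1 / w - 1 / coshRatio w m := by
  unfold coshRatio
  have h1 : w ^ (2 * (m + 1)) + 1 ≠ 0 := by positivity
  have h2 : w ^ (2 * m + 2) + 1 ≠ 0 := by positivity
  have h3 : w ^ (2 * m) + 1 ≠ 0 := by positivity
  field_simp
  ring

theorem half_form_coshRatio_le (hw : 0 < w) (f : ℕ → ℝ) (m : ℕ) :
    coshRatio w m * f m ^ 2 + 2 * ∑ j ∈ Finset.range m, f j * f (j + 1) ≤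
      (w + 1 / w) / 2 * f 0 ^ 2 + (w + 1 / w) * ∑ j ∈ Finset.range m, f (j + 1) ^ 2 := by
  induction m with
  | zero =>
    simp [coshRatio]
    refine le_of_eq ?_
    field_simp
    ring
  | succ m ih =>
    rw [Finset.sum_range_succ, Finset.sum_range_succ, coshRatio_succ hw]
    have hr := coshRatio_pos hw m
    have h : 0 ≤ (coshRatio w m * f m - f (m + 1)) ^ 2 / coshRatio w m := by positivity
    have h2 : (coshRatio w m * f m - f (m + 1)) ^ 2 / coshRatio w m =
      coshRatio w m * f m ^ 2 - 2 * (f m * f (m + 1)) + 1 / coshRatio w m * f (m + 1) ^ 2 := by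
      field_simp; ring
    linarith

theorem mul_geom_sum_sq (w : ℝ) (m : ℕ) :
    (w ^ 2 - 1) * ∑ j ∈ Finset.range m, (w ^ j) ^ 2 = w ^ (2 * m) - 1 := by
  have := mul_geom_sum (w ^ 2) m
  simp only [← pow_mul, mul_comm _ 2] at this ⊢
  exact this

theorem half_form_pow (hw : w ≠ 0) (m : ℕ) :
    w * (w ^ m) ^ 2 + 2 * ∑ j ∈ Finset.range m, w ^ j * w ^ (j + 1) =
      (w + 1 / w) * ∑ j ∈ Finset.range (m + 1), (w ^ j) ^ 2 - 1 / w := by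
  induction m with
  | zero => simp
  | succ m ih =>
    rw [Finset.sum_range_succ, Finset.sum_range_succ _ (m + 1)]
    have : 1 / w * (w ^ (m + 1)) ^ 2 = w * (w ^ m) ^ 2 := by field_simp; ring
    have h3 : w ^ m * w ^ (m + 1) = w * (w ^ m) ^ 2 := by ring
    linarith

/-- The sequence with value `c` at `0`, followed by `a, a * w, a * w ^ 2, …`. -/
def halfTrial (w c a : ℝ) : ℕ → ℝ
  | 0 => c
  | j + 1 => a * w ^ j

theorem halfTrial_sum_sq (c a : ℝ) (m : ℕ) :
    ∑ j ∈ Finset.range m, halfTrial w c a (j + 1) ^ 2 =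
      a ^ 2 * ∑ j ∈ Finset.range m, (w ^ j) ^ 2 := by
  simp only [halfTrial, mul_pow, Finset.mul_sum]

theorem halfTrial_form (hw : w ≠ 0) (c a : ℝ) {m : ℕ} (hm : 1 ≤ m) :
    w * halfTrial w c a m ^ 2 +
        2 * ∑ j ∈ Finset.range m, halfTrial w c a j * halfTrial w c a (j + 1) =
      a ^ 2 * ((w + 1 / w) * ∑ j ∈ Finset.range m, (w ^ j) ^ 2 - 1 / w) + 2 * c * a := by
  obtain ⟨m, rfl⟩ := Nat.exists_eq_add_of_le' hm
  rw [← half_form_pow hw, Finset.sum_range_succ']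
  simp only [halfTrial, pow_zero, mul_one]
  have h : ∑ j ∈ Finset.range m, a * w ^ j * (a * w ^ (j + 1)) =
      a ^ 2 * ∑ j ∈ Finset.range m, w ^ j * w ^ (j + 1) := by
    rw [Finset.mul_sum]
    exact Finset.sum_congr rfl fun j _ => by ring
  rw [h]
  ring

theorem one_le_sum_sq_pow (w : ℝ) {m : ℕ} (hm : 1 ≤ m) :
    1 ≤ ∑ j ∈ Finset.range m, (w ^ j) ^ 2 := by
  simpa using Finset.single_le_sum (f := fun j => (w ^ j) ^ 2) (fun j _ => sq_nonneg _)
    (Finset.mem_range.2 hm)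

theorem sub_coshRatio_le (hw : 1 < w) {m : ℕ} (hm : 1 ≤ m) :
    w - coshRatio w m ≤ 1 / (w * ∑ j ∈ Finset.range m, (w ^ j) ^ 2) := by
  have hS := mul_geom_sum_sq w m
  have hS1 := one_le_sum_sq_pow w hm
  set S := ∑ j ∈ Finset.range m, (w ^ j) ^ 2
  have hw2 : 0 < w ^ 2 - 1 := by nlinarith
  have h : w - coshRatio w m = (w ^ 2 - 1) / (w * (w ^ (2 * m) + 1)) := by
    unfold coshRatio
    have : w ^ (2 * m) + 1 ≠ 0 := by positivity
    field_simp
    ring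
  rw [h, div_le_div_iff₀ (by positivity) (by positivity)]
  nlinarith

end HalfPath

section Eigenvalues

open Matrix

/-- The vector on `2 * m + 1` vertices with value `c` at the centre and geometric halves. -/
def pathTrial (w : ℝ) (m : ℕ) (c s t : ℝ) (k : ℕ) : ℝ :=
  if k < m then halfTrial w c s (m - k) else halfTrial w c t (k - m)

variable {w : ℝ} {m : ℕ}

theorem pathTrial_sub (c s t : ℝ) {j : ℕ} (hj : j ≤ m) :
    pathTrial w m c s t (m - j) = halfTrial w c s j := by
  rcases j with _ | j
  · simp [pathTrial, halfTrial]
  · rw [pathTrial, if_pos (by omega), Nat.sub_sub_self hj]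

theorem pathTrial_add (c s t : ℝ) (j : ℕ) :
    pathTrial w m c s t (m + j) = halfTrial w c t j := by
  simp [pathTrial]

theorem pathTrial_dotProduct_self (c s t : ℝ) :
    (fun i : Fin (2 * m + 1) => pathTrial w m c s t i) ⬝ᵥ
        (fun i : Fin (2 * m + 1) => pathTrial w m c s t i) =
      c ^ 2 + (s ^ 2 + t ^ 2) * ∑ j ∈ Finset.range m, (w ^ j) ^ 2 := by
  have h : ∑ j ∈ Finset.range m, pathTrial w m c s t (m - (j + 1)) ^ 2 =
      ∑ j ∈ Finset.range m, halfTrial w c s (j + 1) ^ 2 :=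
    Finset.sum_congr rfl fun j hj => by rw [pathTrial_sub c s t (Finset.mem_range.1 hj)]
  rw [dotProduct_self_halves, h]
  simp only [pathTrial_add, halfTrial_sum_sq]
  simp only [pathTrial, halfTrial, lt_irrefl, if_false, Nat.sub_self]
  ring

theorem pathTrial_dotProduct_mulVec (hw : w ≠ 0) (hm : 1 ≤ m) (c s t : ℝ) :
    (fun i : Fin (2 * m + 1) => pathTrial w m c s t i) ⬝ᵥ pathA (2 * m + 1) w *ᵥ
        (fun i : Fin (2 * m + 1) => pathTrial w m c s t i) =
      (s ^ 2 + t ^ 2) * ((w + 1 / w) * ∑ j ∈ Finset.range m, (w ^ j) ^ 2 - 1 / w) +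
        2 * c * (s + t) := by
  have h : ∑ j ∈ Finset.range m,
        pathTrial w m c s t (m - j) * pathTrial w m c s t (m - (j + 1)) =
      ∑ j ∈ Finset.range m, halfTrial w c s j * halfTrial w c s (j + 1) :=
    Finset.sum_congr rfl fun j hj => by
      have := Finset.mem_range.1 hj
      rw [pathTrial_sub c s t this, pathTrial_sub c s t this.le]
  rw [pathA_dotProduct_mulVec hm, h, pathTrial_sub c s t le_rfl]
  simp only [pathTrial_add]
  rw [halfTrial_form hw c s hm, halfTrial_form hw c t hm]
  ring

theorem pathTrial_eq_smul_add_smul (s t : ℝ) (k : ℕ) :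
    pathTrial w m 0 s t k = s * pathTrial w m 0 1 0 k + t * pathTrial w m 0 0 1 k := by
  have h (a : ℝ) (j : ℕ) : halfTrial w 0 a j = a * halfTrial w 0 1 j := by
    cases j <;> simp [halfTrial]
  have h0 (j : ℕ) : halfTrial w 0 0 j = 0 := by rw [h, zero_mul]
  unfold pathTrial
  split_ifs
  · rw [h s, h0]; ring
  · rw [h t, h0]; ring

theorem exists_eq_restrict_nat (v : Fin (2 * m + 1) → ℝ) :
    ∃ g : ℕ → ℝ, v = fun i : Fin (2 * m + 1) => g i :=
  ⟨fun k => if h : k < 2 * m + 1 then v ⟨k, h⟩ else 0, by ext i; simp [i.isLt]⟩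

theorem pathA_form_le (hw : 1 < w) (hm : 1 ≤ m) (v : Fin (2 * m + 1) → ℝ) :
    v ⬝ᵥ pathA (2 * m + 1) w *ᵥ v ≤
      (w + 1 / w + 1 / (w * ∑ j ∈ Finset.range m, (w ^ j) ^ 2)) * (v ⬝ᵥ v) := by
  obtain ⟨g, rfl⟩ := exists_eq_restrict_nat v
  have hS := zero_lt_one.trans_le (one_le_sum_sq_pow w hm)
  have hr := sub_coshRatio_le hw hm
  have hw0 : 0 < w := by linarith
  set ε := 1 / (w * ∑ j ∈ Finset.range m, (w ^ j) ^ 2)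
  have hε : 0 < ε := by positivity
  have hhalf (f : ℕ → ℝ) : w * f m ^ 2 + 2 * ∑ j ∈ Finset.range m, f j * f (j + 1) ≤
      (w + 1 / w) / 2 * f 0 ^ 2 + (w + 1 / w + ε) * ∑ j ∈ Finset.range m, f (j + 1) ^ 2 := by
    have h := half_form_coshRatio_le hw0 f m
    have hlast : f m ^ 2 ≤ ∑ j ∈ Finset.range m, f (j + 1) ^ 2 := by
      have := Finset.single_le_sum (f := fun j => f (j + 1) ^ 2) (fun j _ => sq_nonneg _)
        (Finset.mem_range.2 (Nat.sub_lt hm one_pos))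
      simpa [Nat.sub_add_cancel hm] using this
    nlinarith [mul_le_mul_of_nonneg_right hr (sq_nonneg (f m)),
      mul_le_mul_of_nonneg_left hlast hε.le]
  rw [pathA_dotProduct_mulVec hm, dotProduct_self_halves]
  have hl := hhalf fun j => g (m - j)
  have hr := hhalf fun j => g (m + j)
  simp only [Nat.sub_zero, add_zero] at hl hr
  nlinarith [mul_nonneg hε.le (sq_nonneg (g m))]

theorem pathA_form_le_of_centre_eq_zero (hw : 0 < w) (hm : 1 ≤ m) {v : Fin (2 * m + 1) → ℝ}
    (hv : v ⟨m, by omega⟩ = 0) :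
    v ⬝ᵥ pathA (2 * m + 1) w *ᵥ v ≤ (w + 1 / w) * (v ⬝ᵥ v) := by
  obtain ⟨g, rfl⟩ := exists_eq_restrict_nat v
  rw [pathA_dotProduct_mulVec hm, dotProduct_self_halves]
  have hl := half_form_le hw (fun j => g (m - j)) m
  have hr := half_form_le hw (fun j => g (m + j)) m
  simp only at hv
  simp only [Nat.sub_zero, add_zero, hv] at hl hr ⊢
  linarith

/-- Bounds on the two largest eigenvalues of the two-looped path on `2 * m + 1` vertices. -/
theorem eigenvalue_bounds (hw : 1 < w) (hm : 1 ≤ m) {μ : Fin (2 * m + 1) → ℝ}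
    (hμ : IsEigList (2 * m + 1) w μ) {S : ℝ}
    (hS : S = ∑ j ∈ Finset.range m, (w ^ j) ^ 2) {i₀ i₁ : Fin (2 * m + 1)} (h₀ : i₀.val = 0)
    (h₁ : i₁.val = 1) :
    (∀ c, 2 * ((w + 1 / w) * S - 1 / w) + 4 * c ≤ μ i₀ * (c ^ 2 + 2 * S)) ∧
      μ i₀ ≤ w + 1 / w + 1 / (w * S) ∧
      w + 1 / w - 1 / (w * S) ≤ μ i₁ ∧ μ i₁ ≤ w + 1 / w := by
  have hA := pathA_isHermitian (2 * m + 1) w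
  obtain ⟨b, hb⟩ := exists_orthonormalBasis_of_charpoly hA hμ.2
  have hw0 : 0 < w := by linarith
  have hS0 : 0 < S := hS ▸ zero_lt_one.trans_le (one_le_sum_sq_pow w hm)
  have hμ₀ (i) : μ i ≤ μ i₀ := hμ.1 (Fin.le_def.2 (by omega))
  have hμ₁ (i) (hi : i ≠ i₀) : μ i ≤ μ i₁ :=
    hμ.1 (Fin.le_def.2 (by have := Fin.val_ne_of_ne hi; omega))
  refine ⟨fun c => ?_, ?_, ?_, ?_⟩
  · have h := dotProduct_mulVec_le hA hb (c := μ i₀)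
      (v := fun i : Fin (2 * m + 1) => pathTrial w m c 1 1 i)
      fun i hi => absurd (hμ₀ i) hi.not_ge
    rw [pathTrial_dotProduct_mulVec hw0.ne' hm, pathTrial_dotProduct_self, ← hS] at h
    linarith
  · have h := pathA_form_le hw hm (b i₀).ofLp
    rw [hb, dotProduct_smul, dotProduct_basis, ← hS] at h
    simpa using h
  · obtain ⟨s, t, hst, h⟩ := exists_combination_dotProduct_mulVec_le hA hb hμ₁
      (fun s t (i : Fin (2 * m + 1)) => pathTrial w m 0 s t i)
      fun s t => funext fun i => pathTrial_eq_smul_add_smul s t i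
    rw [pathTrial_dotProduct_mulVec hw0.ne' hm, pathTrial_dotProduct_self, ← hS] at h
    have hθ : (w + 1 / w) * S - 1 / w = (w + 1 / w - 1 / (w * S)) * S := by field_simp
    rw [hθ] at h
    refine le_of_mul_le_mul_right ?_ (mul_pos hst hS0)
    linarith
  · obtain ⟨v, hv, hpos, h⟩ := exists_apply_eq_zero_le_dotProduct_mulVec hb
      (i₀ := i₀) (i₁ := i₁) (fun h => by rw [h] at h₀; omega) (hμ₀ i₁) ⟨m, by omega⟩
    exact le_of_mul_le_mul_right (h.trans (pathA_form_le_of_centre_eq_zero hw0 hm hv)) hpos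

end Eigenvalues

theorem mul_le_two_mul_sq (q z S : ℝ) (hq : (q + 1) ^ 2 = 2) :
    ((z + 1) * S + (2 * q + 1)) * (((2 * q + 1) * z - 1) * S + 1) ≤ 2 * (z * S + 1) ^ 2 := by
  have h : 2 * (z * S + 1) ^ 2 - ((z + 1) * S + (2 * q + 1)) * (((2 * q + 1) * z - 1) * S + 1) =
      (S * (q * z - 1) - q) ^ 2 := by
    linear_combination (-(S ^ 2 * z ^ 2) - 2 * S * z - 1) * hq
  nlinarith [sq_nonneg (S * (q * z - 1) - q)]

/-- A lower bound for the larger root of `x * (x - θ) = 2 / S`, `θ = w + 1 / w - 1 / (w * S)`. -/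
theorem lower_bound_of_mul_sub_ge {w S x : ℝ} (hw : 1 < w) (hS : 1 ≤ S) (hx : 0 < x)
    (h : 2 / S ≤ x * (x - (w + 1 / w - 1 / (w * S))))
    (hδ : 0 < 2 * (√2 - 1) * w ^ 2 - 1) :
    w + 1 / w + (2 * (√2 - 1) * w ^ 2 - 1) / (w * (w ^ 2 * S + 1)) ≤ x := by
  set δ := (2 * (√2 - 1) * w ^ 2 - 1) / (w * (w ^ 2 * S + 1)) with hδdef
  have hw0 : 0 < w := by linarith
  have hS0 : 0 < S := by linarith
  have hδ0 : 0 < δ := by positivity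
  by_contra! hlt
  have hy : (w + 1 / w + δ) * (w + 1 / w + δ - (w + 1 / w - 1 / (w * S))) ≤ 2 / S := by
    have hq := mul_le_two_mul_sq (√2 - 1) (w ^ 2) S (by norm_num)
    have e : (w + 1 / w + δ) * (w + 1 / w + δ - (w + 1 / w - 1 / (w * S))) =
        ((w ^ 2 + 1) * S + (2 * (√2 - 1) + 1)) * (((2 * (√2 - 1) + 1) * w ^ 2 - 1) * S + 1) /
          (S * (w ^ 2 * S + 1) ^ 2) := by
      have : w ^ 2 * S + 1 ≠ 0 := by positivity
      rw [hδdef]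
      field_simp
      ring
    rw [e, div_le_div_iff₀ (by positivity) hS0]
    nlinarith [mul_le_mul_of_nonneg_right hq hS0.le]
  have hpos : 0 < w + 1 / w + δ - (w + 1 / w - 1 / (w * S)) := by
    have : 0 < 1 / (w * S) := by positivity
    linarith
  nlinarith


/-- For odd `n ≥ 3` and `w > 1`:
`(2(√2−1)w² − 1)(w²−1)/(w(w^{n+1}−1)) ≤ λ₁ − λ₂ ≤ 4(w−1)(w+1)²/(w²(w^{n−1}−1))`. -/
theorem gap_bounds_odd (n : ℕ) (hn : 3 ≤ n) (hno : Odd n) (w : ℝ) (hw : 1 < w)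
    (μ : Fin n → ℝ) (hμ : IsEigList n w μ) :
    (2 * (Real.sqrt 2 - 1) * w ^ 2 - 1) * (w ^ 2 - 1) / (w * (w ^ (n + 1) - 1))
        ≤ μ ⟨0, by omega⟩ - μ ⟨1, by omega⟩ ∧
    μ ⟨0, by omega⟩ - μ ⟨1, by omega⟩
        ≤ 4 * (w - 1) * (w + 1) ^ 2 / (w ^ 2 * (w ^ (n - 1) - 1)) := by
  obtain ⟨m, rfl⟩ := hno
  have hm : 1 ≤ m := by omega
  obtain ⟨htrial, hupper, hlower, hsecond⟩ := eigenvalue_bounds hw hm hμ rfl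
    (i₀ := ⟨0, by omega⟩) (i₁ := ⟨1, by omega⟩) rfl rfl
  have hgap : μ ⟨1, by omega⟩ ≤ μ ⟨0, by omega⟩ := hμ.1 (Fin.le_def.2 (Nat.zero_le _))
  have hS1 := one_le_sum_sq_pow w hm
  have hgeom := mul_geom_sum_sq w m
  set S := ∑ j ∈ Finset.range m, (w ^ j) ^ 2
  set x := μ ⟨0, by omega⟩
  set y := μ ⟨1, by omega⟩
  clear_value S x y
  have hS0 : 0 < S := by linarith
  have hw0 : 0 < w := by linarith
  have hw2 : 0 < w ^ 2 - 1 := by nlinarith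
  constructor
  · have hpow : w ^ (2 * m + 1 + 1) - 1 = (w ^ 2 - 1) * (w ^ 2 * S + 1) := by
      linear_combination -(w ^ 2) * hgeom
    have hbound : (2 * (√2 - 1) * w ^ 2 - 1) * (w ^ 2 - 1) / (w * (w ^ (2 * m + 1 + 1) - 1)) =
        (2 * (√2 - 1) * w ^ 2 - 1) / (w * (w ^ 2 * S + 1)) := by
      rw [hpow]
      field_simp
    rw [hbound]
    rcases le_or_gt (2 * (√2 - 1) * w ^ 2 - 1) 0 with hneg | hpos
    · exact (div_nonpos_of_nonpos_of_nonneg hneg (by positivity)).trans (sub_nonneg.2 hgap)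
    have hx : 0 < x := by
      have : 1 / (w * S) ≤ 1 / w := by gcongr; nlinarith
      linarith
    have hmul : 2 / S ≤ x * (x - (w + 1 / w - 1 / (w * S))) := by
      have h := htrial (2 / x)
      have e : x * (x - (w + 1 / w - 1 / (w * S))) - 2 / S = x / (2 * S) *
          (x * ((2 / x) ^ 2 + 2 * S) - (2 * ((w + 1 / w) * S - 1 / w) + 4 * (2 / x))) := by
        field_simp
        ring
      have : 0 ≤ x / (2 * S) *
          (x * ((2 / x) ^ 2 + 2 * S) - (2 * ((w + 1 / w) * S - 1 / w) + 4 * (2 / x))) :=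
        mul_nonneg (by positivity) (sub_nonneg.2 h)
      linarith
    have := lower_bound_of_mul_sub_ge hw hS1 hx hmul hpos
    linarith
  · have hbound : 4 * (w - 1) * (w + 1) ^ 2 / (w ^ 2 * (w ^ (2 * m + 1 - 1) - 1)) =
        4 * (w + 1) / (w ^ 2 * S) := by
      have : w - 1 ≠ 0 := by linarith
      rw [Nat.add_sub_cancel, ← hgeom, show w ^ 2 - 1 = (w - 1) * (w + 1) by ring]
      field_simp
    have htwo : 2 * (1 / (w * S)) ≤ 4 * (w + 1) / (w ^ 2 * S) := by
      rw [mul_one_div, div_le_div_iff₀ (by positivity) (by positivity)]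
      have : 0 < w * S := by positivity
      nlinarith
    rw [hbound]
    linarith
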